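/- Let d ≥ 2 and let K, L ⊆ ℝ^d be closed convex sets with nonempty interior, with K ≠ ℝ^d and L ≠ ℝ^d, both satisfying condition (A), and such that at least one of K and L has an extreme point. Assume there exists ε > 0 such that for all orientation-preserving surjective isometries φ, ψ of ℝ^d, if φ(K) ∩ ψ(L) has nonempty interior and diam(φ(K) ∩ ψ(L)) < ε, then φ(K) ∩ ψ(L) is centrally symmetric. Then both K and L are strictly convex, i.e. the frontier of K contains no nondegenerate segment, and likewise for L (equivalently, every boundary point of K is an extreme point of K, and likewise for L). -/

import Mathlib

open Metric Set

noncomputable section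

/-- Euclidean `d`-space. -/
abbrev Euc (d : ℕ) := EuclideanSpace ℝ (Fin d)

/-- A set is centrally symmetric if some point reflection `x ↦ 2c − x` maps it onto itself. -/
def CentrallySymmetric {d : ℕ} (S : Set (Euc d)) : Prop :=
  ∃ c : Euc d, (fun x => (2 : ℝ) • c - x) '' S = S

/-- An affine isometry (congruence) of Euclidean space is orientation preserving if its
linear part has determinant `1`. -/
def OrientationPreserving {d : ℕ} (φ : Euc d ≃ᵃⁱ[ℝ] Euc d) : Prop :=
  LinearMap.det (φ.linearIsometryEquiv.toLinearEquiv : Euc d →ₗ[ℝ] Euc d) = 1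

/-- Condition (A): every frontier point of `K` lies on the boundary of some ball
contained in `K`. -/
def CondA {d : ℕ} (K : Set (Euc d)) : Prop :=
  ∀ x ∈ frontier K, ∃ ε₁ : ℝ, 0 < ε₁ ∧ ∃ c : Euc d, dist x c = ε₁ ∧ closedBall c ε₁ ⊆ K

/-- `K` has an extreme point: a point of `K` not lying in the open segment joining two
distinct points of `K`. -/
def HasExtremePoint {d : ℕ} (K : Set (Euc d)) : Prop :=
  ∃ x ∈ K, ∀ y ∈ K, ∀ z ∈ K, y ≠ z → x ∉ openSegment ℝ y z

section InnerProductSpace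

variable {E : Type*} [NormedAddCommGroup E] [InnerProductSpace ℝ E]

/-- `w` is a strongly exposed point of `K`: the caps cut off from `K` by the hyperplanes with
inner normal `n` shrink to `w`. -/
def StronglyExposedBy (K : Set E) (w n : E) : Prop :=
  w ∈ K ∧ ‖n‖ = 1 ∧
    ∀ r : ℝ, 0 < r → ∃ t : ℝ, 0 < t ∧ ∀ z ∈ K, inner ℝ n (z - w) ≤ t → ‖z - w‖ < r

lemma StronglyExposedBy.eq_of_inner_nonpos {K : Set E} {w n z : E}
    (h : StronglyExposedBy K w n) (hz : z ∈ K) (hle : inner ℝ n (z - w) ≤ 0) : z = w := by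
  by_contra hne
  obtain ⟨t, ht, H⟩ := h.2.2 ‖z - w‖ (norm_pos_iff.2 (sub_ne_zero.2 hne))
  exact lt_irrefl _ (H z hz (hle.trans ht.le))

lemma StronglyExposedBy.inner_nonneg {K : Set E} {w n z : E}
    (h : StronglyExposedBy K w n) (hz : z ∈ K) : 0 ≤ inner ℝ n (z - w) := by
  by_contra hneg
  have hzw := h.eq_of_inner_nonpos hz (not_le.1 hneg).le
  simp [hzw] at hneg

lemma eventually_add_smul_mem {K : Set E} {w : E} (hw : K ∈ nhds w) (v : E) :
    ∀ᶠ s : ℝ in nhdsWithin 0 (Ioi 0), w + s • v ∈ K := by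
  have hc : Filter.Tendsto (fun s : ℝ => w + s • v) (nhds 0) (nhds w) := by
    have : Continuous fun s : ℝ => w + s • v := by fun_prop
    simpa using this.tendsto 0
  exact (hc.eventually hw).filter_mono nhdsWithin_le_nhds

lemma StronglyExposedBy.mem_frontier {K : Set E} {w n : E} (h : StronglyExposedBy K w n) :
    w ∈ frontier K := by
  refine ⟨subset_closure h.1, fun hCint => ?_⟩
  obtain ⟨s, hs, hs0⟩ := ((eventually_add_smul_mem (mem_interior_iff_mem_nhds.1 hCint) (-n)).and
    self_mem_nhdsWithin).exists
  have hs0 : 0 < s := hs0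
  have h0 := h.inner_nonneg hs
  simp only [add_sub_cancel_left, smul_neg, inner_neg_right, inner_smul_right,
    real_inner_self_eq_norm_sq, h.2.1] at h0
  linarith

lemma center_eq_of_closedBall_subset {K : Set E} {w n c : E} {ε : ℝ} (hn : ‖n‖ = 1)
    (hK : ∀ z ∈ K, 0 ≤ inner ℝ n (z - w)) (hε : 0 < ε) (hwc : dist w c = ε)
    (hball : closedBall c ε ⊆ K) : c = w + ε • n := by
  have hz : c - ε • n ∈ K := hball (by
    simp [norm_smul, hn, abs_of_pos hε])
  have h1 := hK _ hz
  rw [sub_right_comm, inner_sub_right, inner_smul_right, real_inner_self_eq_norm_sq, hn] at h1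
  have h2 : ‖c - w‖ = ε := by rw [← hwc, dist_comm, dist_eq_norm]
  have h3 := norm_sub_sq_real (c - w) (ε • n)
  rw [h2, inner_smul_right, norm_smul, hn, real_inner_comm, Real.norm_of_nonneg hε.le] at h3
  have h4 : ‖c - w - ε • n‖ ^ 2 ≤ 0 := by nlinarith
  have h5 : c - w - ε • n = 0 := by
    rw [← norm_eq_zero]; exact pow_eq_zero_iff two_ne_zero |>.1 (le_antisymm h4 (sq_nonneg _))
  rw [sub_sub, sub_eq_zero] at h5
  exact h5

lemma IsCompact.convexJoin {s t : Set E} (hs : IsCompact s) (ht : IsCompact t) :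
    IsCompact (convexJoin ℝ s t) := by
  have himage : _root_.convexJoin ℝ s t =
      (fun p : ℝ × E × E => (1 - p.1) • p.2.1 + p.1 • p.2.2) '' (Icc 0 1 ×ˢ s ×ˢ t) := by
    ext x
    simp only [mem_convexJoin, segment_eq_image, mem_image, Prod.exists, mem_prod]
    constructor
    · rintro ⟨a, ha, b, hb, θ, hθ, rfl⟩
      exact ⟨θ, a, b, ⟨hθ, ha, hb⟩, rfl⟩
    · rintro ⟨θ, a, b, ⟨hθ, ha, hb⟩, rfl⟩
      exact ⟨a, ha, b, hb, θ, hθ, rfl⟩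
  rw [himage]
  exact (isCompact_Icc.prod (hs.prod ht)).image (by fun_prop)

/-- A compact subset of a closed convex set which misses an extreme point is contained in a compact
convex subset missing that extreme point. -/
lemma exists_isCompact_convex_of_mem_extremePoints [FiniteDimensional ℝ E] {K S : Set E} {e : E}
    (hKcl : IsClosed K) (hK : Convex ℝ K) (he : e ∈ K.extremePoints ℝ) (hS : IsCompact S)
    (hSK : S ⊆ K \ {e}) : ∃ T, IsCompact T ∧ Convex ℝ T ∧ S ⊆ T ∧ T ⊆ K \ {e} := by
  have hKe : Convex ℝ (K \ {e}) := (hK.mem_extremePoints_iff_convex_sdiff.1 he).2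
  suffices h : ∃ T, IsCompact T ∧ Convex ℝ T ∧ S ∩ S ⊆ T ∧ T ⊆ K \ {e} by simpa using h
  refine hS.induction_on (p := fun A => ∃ T, IsCompact T ∧ Convex ℝ T ∧ A ∩ S ⊆ T ∧ T ⊆ K \ {e})
    ⟨∅, isCompact_empty, convex_empty, by simp, by simp⟩ ?_ ?_ ?_
  · rintro A B hAB ⟨T, h1, h2, h3, h4⟩
    exact ⟨T, h1, h2, (inter_subset_inter_left _ hAB).trans h3, h4⟩
  · rintro A B ⟨T, h1, h2, h3, h4⟩ ⟨U, g1, g2, g3, g4⟩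
    rw [union_inter_distrib_right]
    rcases T.eq_empty_or_nonempty with rfl | hT
    · exact ⟨U, g1, g2, union_subset (h3.trans (empty_subset _)) g3, g4⟩
    rcases U.eq_empty_or_nonempty with rfl | hU
    · exact ⟨T, h1, h2, union_subset h3 (g3.trans (empty_subset _)), h4⟩
    exact ⟨convexJoin ℝ T U, h1.convexJoin g1, h2.convexJoin g2,
      union_subset (h3.trans (subset_convexJoin_left hU)) (g3.trans (subset_convexJoin_right hT)),
      convexJoin_subset h4 g4 hKe⟩
  · intro z hz
    have hd : 0 < dist z e := dist_pos.2 fun h => (hSK hz).2 h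
    refine ⟨closedBall z (dist z e / 2),
      mem_nhdsWithin_of_mem_nhds (closedBall_mem_nhds _ (by positivity)),
      closedBall z (dist z e / 2) ∩ K, (isCompact_closedBall _ _).inter_right hKcl,
      (convex_closedBall _ _).inter hK, inter_subset_inter_right _ fun x hx => (hSK hx).1, ?_⟩
    rintro x ⟨hx, hxK⟩
    refine ⟨hxK, ?_⟩
    rintro rfl
    rw [mem_closedBall, dist_comm] at hx
    linarith

/-- A hyperplane cuts a bounded cap around an extreme point off a closed convex set. -/
lemma exists_bounded_cap [FiniteDimensional ℝ E] {K : Set E} {e : E}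
    (hKcl : IsClosed K) (hK : Convex ℝ K) (he : e ∈ K.extremePoints ℝ) :
    ∃ (g : E) (δ : ℝ), 0 < δ ∧ ∀ z ∈ K, inner ℝ g (z - e) ≤ δ → ‖z - e‖ ≤ 1 := by
  obtain ⟨T, hT, hTc, hST, hTK⟩ := exists_isCompact_convex_of_mem_extremePoints hKcl hK he
    ((isCompact_sphere e 1).inter_right hKcl) (S := sphere e 1 ∩ K) (by
      rintro x ⟨hx, hxK⟩
      refine ⟨hxK, ?_⟩
      rintro rfl
      simp at hx)
  obtain ⟨f, u, hfe, hfT⟩ := geometric_hahn_banach_point_closed hTc hT.isClosed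
    (fun h => (hTK h).2 rfl : e ∉ T)
  refine ⟨(InnerProductSpace.toDual ℝ E).symm f, u - f e, by linarith, fun z hz hfz => ?_⟩
  rw [InnerProductSpace.toDual_symm_apply, map_sub] at hfz
  by_contra! hlt
  have hpos : 0 < ‖z - e‖ := by linarith
  have hle : ‖z - e‖⁻¹ ≤ 1 := inv_le_one_of_one_le₀ hlt.le
  have hmem : e + ‖z - e‖⁻¹ • (z - e) ∈ T := hST ⟨by
    simp [norm_smul, hpos.ne'],
    hK.add_smul_sub_mem he.1 hz ⟨by positivity, hle⟩⟩
  have h1 := hfT _ hmem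
  simp only [map_add, map_smul, map_sub, smul_eq_mul] at h1
  nlinarith [mul_le_mul_of_nonneg_left hfz (inv_pos.2 hpos).le]

/-- A closed convex set with nonempty interior and an extreme point has a strongly exposed point. -/
lemma exists_stronglyExposedBy [FiniteDimensional ℝ E] [Nontrivial E] {K : Set E} {e : E}
    (hKcl : IsClosed K) (hK : Convex ℝ K) (hKint : (interior K).Nonempty)
    (he : e ∈ K.extremePoints ℝ) : ∃ w n, StronglyExposedBy K w n := by
  obtain ⟨g, δ, hδ, hcap⟩ := exists_bounded_cap hKcl hK he
  set D : Set E := {z ∈ K | inner ℝ g (z - e) ≤ δ} with hD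
  have hDcl : IsClosed D := hKcl.inter (isClosed_le
    (by fun_prop : Continuous fun z => inner ℝ g (z - e)) continuous_const)
  have hDcomp : IsCompact D := (isCompact_closedBall e 1).of_isClosed_subset hDcl
    fun z hz => by simpa [dist_eq_norm] using hcap z hz.1 hz.2
  have heD : e ∈ D := ⟨he.1, by simpa using hδ.le⟩
  set m : E := e + δ⁻¹ • g with hm
  obtain ⟨w, hwD, hmax⟩ := hDcomp.exists_isMaxOn ⟨e, heD⟩
    (by fun_prop : ContinuousOn (fun z => ‖z - m‖) D)
  have hmax : ∀ z ∈ D, ‖z - m‖ ≤ ‖w - m‖ := fun z hz => hmax hz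
  have hwlt : inner ℝ g (w - e) < δ := by
    refine lt_of_le_of_ne hwD.2 fun heq => ?_
    have h1 := hmax e heD
    have h2 : ‖e - m‖ = ‖δ⁻¹ • g‖ := by rw [hm, sub_add_cancel_left, norm_neg]
    have h3 : ‖w - m‖ ^ 2 = ‖w - e‖ ^ 2 - 2 + ‖δ⁻¹ • g‖ ^ 2 := by
      rw [hm, ← sub_sub, norm_sub_sq_real, inner_smul_right, real_inner_comm, heq]
      field_simp
    have h4 := hcap w hwD.1 hwD.2
    nlinarith [norm_nonneg (w - e), norm_nonneg (e - m)]
  have hquad : ∀ z ∈ D, ‖z - w‖ ^ 2 ≤ 2 * inner ℝ (m - w) (z - w) := by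
    intro z hz
    have h1 := hmax z hz
    have h2 : ‖z - m‖ ^ 2 = ‖z - w‖ ^ 2 - 2 * inner ℝ (m - w) (z - w) + ‖w - m‖ ^ 2 := by
      rw [show z - m = (z - w) - (m - w) by abel, norm_sub_sq_real, real_inner_comm,
        norm_sub_rev m w]
    nlinarith [norm_nonneg (z - m)]
  have hshrink : ∀ r : ℝ, 0 < r →
      ∃ t : ℝ, 0 < t ∧ ∀ z ∈ K, inner ℝ (m - w) (z - w) ≤ t → ‖z - w‖ < r := by
    intro r hr
    set η : ℝ := δ - inner ℝ g (w - e) with hη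
    have hη0 : 0 < η := by linarith
    set B : ℝ := ‖g‖ + 1 with hB
    have hB0 : 0 < B := by positivity
    set ρ : ℝ := min r (η / B) with hρ
    have hρ0 : 0 < ρ := lt_min hr (by positivity)
    refine ⟨ρ ^ 2 / 4, by positivity, fun z hz hzt => ?_⟩
    by_contra! hle
    have hρz : ρ ≤ ‖z - w‖ := (min_le_left _ _).trans hle
    have hz0 : 0 < ‖z - w‖ := hρ0.trans_le hρz
    have hl1 : ρ / ‖z - w‖ ≤ 1 := (div_le_one hz0).2 hρz
    set l : ℝ := ρ / ‖z - w‖ with hl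
    have hl0 : 0 < l := by positivity
    have hnorm : ‖l • (z - w)‖ = ρ := by
      rw [norm_smul, Real.norm_of_nonneg hl0.le, hl, div_mul_cancel₀ _ hz0.ne']
    have hmem : w + l • (z - w) ∈ D := by
      refine ⟨hK.add_smul_sub_mem hwD.1 hz ⟨hl0.le, hl1⟩, ?_⟩
      have h1 : inner ℝ g (l • (z - w)) ≤ ‖g‖ * ρ := hnorm ▸ real_inner_le_norm _ _
      have h2 : B * ρ ≤ η := by
        have := min_le_right r (η / B)
        rw [le_div_iff₀ hB0] at this
        linarith
      rw [add_sub_right_comm, inner_add_right]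
      nlinarith
    have h1 := hquad _ hmem
    rw [add_sub_cancel_left, hnorm, inner_smul_right] at h1
    nlinarith
  have hne : m - w ≠ 0 := by
    intro h0
    obtain ⟨p, hp⟩ := hKint
    obtain ⟨v, hv⟩ := exists_ne (0 : E)
    obtain ⟨s, hs, hs0⟩ := ((eventually_add_smul_mem (mem_interior_iff_mem_nhds.1 hp) v).and
      self_mem_nhdsWithin).exists
    have hs0 : 0 < s := hs0
    have hKw : ∀ z ∈ K, z = w := by
      intro z hz
      by_contra hzw
      obtain ⟨t, ht, H⟩ := hshrink ‖z - w‖ (norm_pos_iff.2 (sub_ne_zero.2 hzw))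
      exact lt_irrefl _ (H z hz (by simpa [h0] using ht.le))
    have := (hKw _ hs).trans (hKw _ (interior_subset hp)).symm
    simp [hs0.ne', hv] at this
  have hn0 : 0 < ‖m - w‖ := norm_pos_iff.2 hne
  refine ⟨w, ‖m - w‖⁻¹ • (m - w), hwD.1, by simp [norm_smul, hn0.ne'], fun r hr => ?_⟩
  obtain ⟨t, ht, H⟩ := hshrink r hr
  refine ⟨‖m - w‖⁻¹ * t, by positivity, fun z hz hle => H z hz ?_⟩
  rw [real_inner_smul_left] at hle
  exact le_of_mul_le_mul_left hle (inv_pos.2 hn0)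

/-- A convex set with nonempty interior has a unit outer normal at every frontier point. -/
lemma Convex.exists_unit_normal [CompleteSpace E] {L : Set E} (hL : Convex ℝ L)
    (hLint : (interior L).Nonempty) {y : E} (hy : y ∈ frontier L) :
    ∃ m : E, ‖m‖ = 1 ∧ ∀ z ∈ L, inner ℝ m (z - y) ≤ 0 := by
  obtain ⟨f, hf0, hf⟩ := geometric_hahn_banach_of_nonempty_interior_point hL hy.2 hLint
  set g := (InnerProductSpace.toDual ℝ E).symm f with hg
  have hg0 : 0 < ‖g‖ := norm_pos_iff.2 (by simpa [hg] using hf0)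
  refine ⟨‖g‖⁻¹ • g, by simp [norm_smul, hg0.ne'], fun z hz => ?_⟩
  rw [real_inner_smul_left, hg, InnerProductSpace.toDual_symm_apply, map_sub]
  exact mul_nonpos_of_nonneg_of_nonpos (by positivity) (sub_nonpos.2 (hf z hz))

lemma reflection_det_eq_neg_one [FiniteDimensional ℝ E] {v : E} (hv : v ≠ 0) :
    LinearMap.det ((ℝ ∙ v)ᗮ.reflection.toLinearEquiv : E →ₗ[ℝ] E) = -1 := by
  have h := Submodule.det_reflection (𝕜 := ℝ) (ℝ ∙ v)ᗮ
  rw [Submodule.orthogonal_orthogonal, finrank_span_singleton hv, pow_one] at h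
  exact h

/-- In dimension at least two, rotations act transitively on the unit sphere. -/
lemma exists_rotation [FiniteDimensional ℝ E] (hd : 2 ≤ Module.finrank ℝ E) {n m : E}
    (hn : ‖n‖ = 1) (hm : ‖m‖ = 1) : ∃ R : E ≃ₗᵢ[ℝ] E,
      LinearMap.det (R.toLinearEquiv : E →ₗ[ℝ] E) = 1 ∧ R n = m := by
  by_cases hnm : n = m
  · exact ⟨LinearIsometryEquiv.refl ℝ E, LinearMap.det_id, by simpa using hnm⟩
  obtain ⟨v, hv, hv0⟩ : ∃ v ∈ (ℝ ∙ m)ᗮ, v ≠ 0 := by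
    refine Submodule.exists_mem_ne_zero_of_ne_bot fun hbot => ?_
    have h1 := Submodule.finrank_add_finrank_orthogonal (ℝ ∙ m)
    have h2 := finrank_span_singleton (K := ℝ) (v := m) (by rintro rfl; simp at hm)
    rw [hbot, finrank_bot, h2] at h1
    omega
  refine ⟨(ℝ ∙ (n - m))ᗮ.reflection.trans (ℝ ∙ v)ᗮ.reflection, ?_, ?_⟩
  · have hcomp : (((ℝ ∙ (n - m))ᗮ.reflection.trans (ℝ ∙ v)ᗮ.reflection).toLinearEquiv :
        E →ₗ[ℝ] E) = ((ℝ ∙ v)ᗮ.reflection.toLinearEquiv : E →ₗ[ℝ] E) *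
          ((ℝ ∙ (n - m))ᗮ.reflection.toLinearEquiv : E →ₗ[ℝ] E) := rfl
    rw [hcomp, map_mul, reflection_det_eq_neg_one hv0,
      reflection_det_eq_neg_one (sub_ne_zero.2 hnm)]
    norm_num
  · rw [LinearIsometryEquiv.trans_apply, Submodule.reflection_sub (hn.trans hm.symm)]
    refine Submodule.reflection_mem_subspace_eq_self ?_
    rw [Submodule.mem_orthogonal_singleton_iff_inner_left] at hv
    rwa [Submodule.mem_orthogonal_singleton_iff_inner_left, real_inner_comm]

lemma inner_eq_zero_of_mem_openSegment {m a b y : E} (hy : y ∈ openSegment ℝ a b)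
    (ha : inner ℝ m (a - y) ≤ 0) (hb : inner ℝ m (b - y) ≤ 0) :
    inner ℝ m (a - y) = 0 ∧ inner ℝ m (b - y) = 0 := by
  obtain ⟨α, β, hα, hβ, hαβ, rfl⟩ := hy
  set y := α • a + β • b
  have h : α * inner ℝ m (a - y) + β * inner ℝ m (b - y) = 0 := by
    rw [← inner_smul_right, ← inner_smul_right, ← inner_add_right, smul_sub, smul_sub,
      sub_add_sub_comm, ← add_smul, hαβ, one_smul, sub_self, inner_zero_right]
  constructor <;> nlinarith

lemma mem_extremePoints_of_mem_frontier [CompleteSpace E] {L : Set E} (hLcl : IsClosed L)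
    (hL : Convex ℝ L) (hLint : (interior L).Nonempty)
    (hstrict : ∀ x y : E, x ≠ y → ¬ segment ℝ x y ⊆ frontier L) {y : E} (hy : y ∈ frontier L) :
    y ∈ L.extremePoints ℝ := by
  refine mem_extremePoints_iff_left.2 ⟨hLcl.frontier_subset hy, fun a ha b hb hyab => ?_⟩
  by_contra hay
  have hab : a ≠ b := by
    rintro rfl
    rw [openSegment_same] at hyab
    exact hay hyab.symm
  obtain ⟨m, hm, hmL⟩ := hL.exists_unit_normal hLint hy
  obtain ⟨ha0, hb0⟩ := inner_eq_zero_of_mem_openSegment hyab (hmL a ha) (hmL b hb)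
  refine hstrict a b hab fun z hz => ⟨subset_closure (hL.segment_subset ha hb hz), fun hzint => ?_⟩
  obtain ⟨s, hs, hs0⟩ := ((eventually_add_smul_mem (mem_interior_iff_mem_nhds.1 hzint) m).and
    self_mem_nhdsWithin).exists
  have hs0 : 0 < s := hs0
  have h := hmL _ hs
  obtain ⟨α, β, -, -, hαβ, rfl⟩ := hz
  have hzy : α • a + β • b + s • m - y = α • (a - y) + β • (b - y) + s • m := by
    obtain rfl : β = 1 - α := by linarith
    module
  rw [hzy, inner_add_right, inner_add_right, inner_smul_right, inner_smul_right, inner_smul_right,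
    ha0, hb0, real_inner_self_eq_norm_sq, hm] at h
  linarith

end InnerProductSpace

/-- If small intersections are centrally symmetric and `K` has a strongly exposed point, then the
frontier of `L` contains no segment. -/
lemma not_segment_subset_frontier_of_stronglyExposedBy {d : ℕ} (hd : 2 ≤ d) {K L : Set (Euc d)}
    (hLcl : IsClosed L) (hL : Convex ℝ L) (hLint : (interior L).Nonempty)
    (hKA : CondA K) (hLA : CondA L) {w n : Euc d} (hw : StronglyExposedBy K w n)
    {ε : ℝ} (hε : 0 < ε)
    (hsymm : ∀ φ : Euc d ≃ᵃⁱ[ℝ] Euc d, OrientationPreserving φ →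
      (interior (φ '' K ∩ L)).Nonempty → diam (φ '' K ∩ L) < ε →
      CentrallySymmetric (φ '' K ∩ L))
    {a b : Euc d} (hab : a ≠ b) : ¬ segment ℝ a b ⊆ frontier L := by
  intro hseg
  obtain ⟨ε₁, hε₁, c₁, hc₁, hball₁⟩ := hKA w hw.mem_frontier
  obtain rfl := center_eq_of_closedBall_subset hw.2.1 (fun z => hw.inner_nonneg) hε₁ hc₁ hball₁
  have hymid := midpoint_mem_openSegment (𝕜 := ℝ) a b
  set y := midpoint ℝ a b with hy
  have hyb : y ≠ b := by simpa [hy] using hab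
  have hyF : y ∈ frontier L := hseg (openSegment_subset_segment _ _ _ hymid)
  have haL : a ∈ L := hLcl.frontier_subset (hseg (left_mem_segment _ _ _))
  have hbL : b ∈ L := hLcl.frontier_subset (hseg (right_mem_segment _ _ _))
  have hyL : y ∈ L := hLcl.frontier_subset hyF
  obtain ⟨m, hm, hmL⟩ := hL.exists_unit_normal hLint hyF
  have hb0 := (inner_eq_zero_of_mem_openSegment hymid (hmL a haL) (hmL b hbL)).2
  obtain ⟨ε₂, hε₂, c₂, hc₂, hball₂⟩ := hLA y hyF
  obtain rfl := center_eq_of_closedBall_subset (n := -m) (by rwa [norm_neg])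
    (fun z hz => by rw [inner_neg_left]; linarith [hmL z hz]) hε₂ hc₂ hball₂
  obtain ⟨t₀, ht₀, hcap⟩ := hw.2.2 (ε / 3) (by positivity)
  obtain ⟨t, ht, htmin⟩ : ∃ t, 0 < t ∧ t ≤ min t₀ (min ε₁ ε₂) :=
    ⟨_, by positivity, le_rfl⟩
  obtain ⟨htt₀, htε₁, htε₂⟩ : t ≤ t₀ ∧ t ≤ ε₁ ∧ t ≤ ε₂ := by simpa using htmin
  obtain ⟨R, hRdet, hRn⟩ := exists_rotation (n := n) (m := m) (by simpa using hd) hw.2.1 hm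
  set φ : Euc d ≃ᵃⁱ[ℝ] Euc d :=
    R.toAffineIsometryEquiv.trans (AffineIsometryEquiv.constVAdd ℝ (Euc d) (y - t • m - R w))
  have hφ : ∀ z, φ z = y - t • m + R (z - w) := by
    intro z
    have : φ z = (y - t • m - R w) + R z := rfl
    rw [this, map_sub]
    abel
  have hφO : OrientationPreserving φ := hRdet
  have hinner : ∀ z, inner ℝ m (φ z - y) = inner ℝ n (z - w) - t := by
    intro z
    rw [hφ, show y - t • m + R (z - w) - y = R (z - w) - t • m by abel, inner_sub_right,
      inner_smul_right, real_inner_self_eq_norm_sq, hm, ← hRn, R.inner_map_map]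
    ring
  have hyint : y ∈ interior (φ '' K) := by
    have h1 : y = φ (w + t • n) := by simp [hφ, hRn]
    have h2 : w + t • n ∈ interior K := by
      refine interior_mono hball₁ (ball_subset_interior_closedBall ?_)
      rw [mem_ball, dist_eq_norm, add_sub_add_left_eq_sub, ← sub_smul, norm_smul, hw.2.1, mul_one,
        Real.norm_eq_abs, abs_lt]
      constructor <;> linarith
    have h3 : φ.toHomeomorph '' interior K = interior (φ '' K) := φ.toHomeomorph.image_interior K
    rw [← h3, h1]
    exact ⟨_, h2, rfl⟩
  have hxL : φ w ∈ L := by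
    refine hball₂ ?_
    rw [hφ, sub_self, map_zero, add_zero, mem_closedBall, dist_eq_norm,
      show y - t • m - (y + ε₂ • -m) = (ε₂ - t) • m by module, norm_smul, hm, mul_one,
      Real.norm_eq_abs, abs_le]
    constructor <;> linarith
  have hdiam : diam (φ '' K ∩ L) < ε := by
    have hclose : ∀ z ∈ φ '' K ∩ L, dist z (φ w) < ε / 3 := by
      rintro _ ⟨⟨k, hk, rfl⟩, hkL⟩
      rw [φ.dist_map, dist_eq_norm]
      refine hcap k hk ?_
      have := hmL _ hkL
      rw [hinner] at this
      linarith
    refine (diam_le_of_forall_dist_le (C := 2 * (ε / 3)) (by positivity)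
      fun z hz z' hz' => ?_).trans_lt (by linarith)
    linarith [dist_triangle_right z z' (φ w), hclose z hz, hclose z' hz']
  have hCint : (interior (φ '' K ∩ L)).Nonempty := by
    rw [interior_inter]
    refine mem_closure_iff.1 ?_ _ isOpen_interior hyint
    rw [hL.closure_interior_eq_closure_of_nonempty_interior hLint]
    exact subset_closure hyL
  obtain ⟨c, hc⟩ := hsymm φ hφO hCint hdiam
  have hrefl : ∀ z ∈ φ '' K ∩ L, (2 : ℝ) • c - z ∈ φ '' K ∩ L := by
    intro z hz
    have := mem_image_of_mem (fun x => (2 : ℝ) • c - x) hz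
    rwa [hc] at this
  have hxC : φ w ∈ φ '' K ∩ L := ⟨mem_image_of_mem _ hw.1, hxL⟩
  have htop : ∀ z ∈ φ '' K ∩ L, inner ℝ m (z - y) = 0 → (2 : ℝ) • c - z = φ w := by
    intro z hz hz0
    obtain ⟨k, hk, hkz⟩ := (hrefl z hz).1
    have h1 := hmL _ (hrefl _ hxC).2
    have h2 : (2 : ℝ) • c - φ w - y = (φ k - y) - (φ w - y) + (z - y) := by rw [hkz]; abel
    rw [h2, inner_add_right, inner_sub_right, hz0, hinner, hinner, sub_self, inner_zero_right] at h1
    rw [← hkz, hw.eq_of_inner_nonpos hk (by linarith)]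
  obtain ⟨s, ⟨hsK, hs1⟩, hs0⟩ :=
    (((eventually_add_smul_mem (mem_interior_iff_mem_nhds.1 hyint) (b - y)).and
      ((eventually_le_nhds zero_lt_one).filter_mono nhdsWithin_le_nhds)).and
        self_mem_nhdsWithin).exists
  have hs0 : 0 < s := hs0
  have hyz := (htop y ⟨interior_subset hyint, hyL⟩ (by simp)).trans
    (htop (y + s • (b - y)) ⟨hsK, hL.add_smul_sub_mem hyL hbL ⟨hs0.le, hs1⟩⟩
      (by rw [add_sub_cancel_left, inner_smul_right, hb0, mul_zero])).symm
  have hzero : s • (b - y) = 0 := by simpa using sub_right_injective hyz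
  exact (smul_ne_zero hs0.ne' (sub_ne_zero.2 hyb.symm)) hzero

lemma orientationPreserving_refl (d : ℕ) :
    OrientationPreserving (AffineIsometryEquiv.refl ℝ (Euc d)) := LinearMap.det_id

lemma HasExtremePoint.exists_mem_extremePoints {d : ℕ} {K : Set (Euc d)}
    (h : HasExtremePoint K) : ∃ e, e ∈ K.extremePoints ℝ := by
  obtain ⟨e, he, H⟩ := h
  refine ⟨e, mem_extremePoints_iff_left.2 ⟨he, fun x hx y hy hxy => ?_⟩⟩
  rcases eq_or_ne x y with rfl | hne
  · rw [openSegment_same] at hxy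
    exact hxy.symm
  · exact absurd hxy (H x hx y hy hne)

/-- One-sided form of the theorem: an extreme point of `K` forces strict convexity of both sets. -/
lemma not_segment_subset_frontier_of_mem_extremePoints {d : ℕ} (hd : 2 ≤ d) {K L : Set (Euc d)}
    (hKcl : IsClosed K) (hK : Convex ℝ K) (hKint : (interior K).Nonempty)
    (hLcl : IsClosed L) (hL : Convex ℝ L) (hLint : (interior L).Nonempty) (hLne : L ≠ univ)
    (hKA : CondA K) (hLA : CondA L) {e : Euc d} (he : e ∈ K.extremePoints ℝ)
    {ε : ℝ} (hε : 0 < ε)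
    (hsymm : ∀ φ ψ : Euc d ≃ᵃⁱ[ℝ] Euc d,
      OrientationPreserving φ → OrientationPreserving ψ →
      (interior (φ '' K ∩ ψ '' L)).Nonempty → diam (φ '' K ∩ ψ '' L) < ε →
      CentrallySymmetric (φ '' K ∩ ψ '' L)) :
    (∀ x y : Euc d, x ≠ y → ¬ segment ℝ x y ⊆ frontier K) ∧
    (∀ x y : Euc d, x ≠ y → ¬ segment ℝ x y ⊆ frontier L) := by
  have : Nontrivial (Euc d) :=
    Module.nontrivial_of_finrank_pos (R := ℝ) (by rw [finrank_euclideanSpace_fin]; omega)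
  obtain ⟨w, n, hw⟩ := exists_stronglyExposedBy hKcl hK hKint he
  have hLstrict : ∀ x y : Euc d, x ≠ y → ¬ segment ℝ x y ⊆ frontier L := fun x y hxy =>
    not_segment_subset_frontier_of_stronglyExposedBy hd hLcl hL hLint hKA hLA hw hε
      (fun φ hφ => by simpa using hsymm φ (.refl ℝ _) hφ (orientationPreserving_refl d)) hxy
  refine ⟨fun x y hxy => ?_, hLstrict⟩
  obtain ⟨p, hp⟩ : (frontier L).Nonempty :=
    nonempty_frontier_iff.2 ⟨hLint.mono interior_subset, hLne⟩
  obtain ⟨w', n', hw'⟩ := exists_stronglyExposedBy hLcl hL hLint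
    (mem_extremePoints_of_mem_frontier hLcl hL hLint hLstrict hp)
  exact not_segment_subset_frontier_of_stronglyExposedBy hd hKcl hK hKint hLA hKA hw' hε
    (fun ψ hψ => by
      simpa [inter_comm] using hsymm (.refl ℝ _) ψ (orientationPreserving_refl d) hψ) hxy

/-- If all small intersections of congruent copies of `K` and `L` with nonempty interior
are centrally symmetric, then `K` and `L` are strictly convex. -/
theorem strict_convexity_of_small_intersections_centrally_symmetric
    (d : ℕ) (hd : 2 ≤ d) (K L : Set (Euc d))
    (hKcl : IsClosed K) (hKconv : Convex ℝ K) (hKint : (interior K).Nonempty)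
    (hKne : K ≠ univ)
    (hLcl : IsClosed L) (hLconv : Convex ℝ L) (hLint : (interior L).Nonempty)
    (hLne : L ≠ univ)
    (hKA : CondA K) (hLA : CondA L)
    (hext : HasExtremePoint K ∨ HasExtremePoint L)
    (hsymm : ∃ ε : ℝ, 0 < ε ∧ ∀ φ ψ : Euc d ≃ᵃⁱ[ℝ] Euc d,
        OrientationPreserving φ → OrientationPreserving ψ →
        (interior (φ '' K ∩ ψ '' L)).Nonempty → diam (φ '' K ∩ ψ '' L) < ε →
        CentrallySymmetric (φ '' K ∩ ψ '' L)) :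
    (∀ x y : Euc d, x ≠ y → ¬ segment ℝ x y ⊆ frontier K) ∧
    (∀ x y : Euc d, x ≠ y → ¬ segment ℝ x y ⊆ frontier L) := by
  obtain ⟨ε, hε, hsymm⟩ := hsymm
  rcases hext with hext | hext
  · obtain ⟨e, he⟩ := hext.exists_mem_extremePoints
    exact not_segment_subset_frontier_of_mem_extremePoints hd hKcl hKconv hKint hLcl hLconv hLint
      hLne hKA hLA he hε hsymm
  · obtain ⟨e, he⟩ := hext.exists_mem_extremePoints
    exact (not_segment_subset_frontier_of_mem_extremePoints hd hLcl hLconv hLint hKcl hKconv hKint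
      hKne hLA hKA he hε fun ψ φ hψ hφ => by
        simpa only [inter_comm] using hsymm φ ψ hφ hψ).symm
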